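/- Let C be an [n_c, ⌈n_c/2⌉]_q MDS code whose codeword set is partitioned into q^2 subsets C_1,…,C_{q^2}, each of which is (a coset of) an MDS code with parameters [n_c, ⌈n_c/2⌉ - 2]_q (minimum pairwise distance ⌊n_c/2⌋ + 3 within each subset). Let {|ψ_i⟩}_{i=1}^{q^2} be the generalized Bell basis of C^q ⊗ C^q. Then the state |φ⟩ = q^{-⌈n_c/2⌉/2} Σ_{i=1}^{q^2} Σ_{c ∈ C_i} |c⟩|ψ_i⟩ on n = n_c + 2 qudits has all reductions to ⌊n/2⌋ parties maximally mixed, i.e., |φ⟩ is an absolutely maximally entangled state AME(n_c+2, q) with n_c + 2 odd. -/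

import Mathlib

open scoped BigOperators

/-- Combine an assignment on `S` and on its complement into a full assignment. -/
def mergeOn {ι α : Type*} [DecidableEq ι] (S : Finset ι)
    (a : {i // i ∈ S} → α) (b : {i // i ∉ S} → α) : ι → α :=
  fun i => if h : i ∈ S then a ⟨i, h⟩ else b ⟨i, h⟩

/-- Reduced density matrix on the subset `S`, tracing out the complement. -/
noncomputable def reducedMatrix {ι α : Type*} [Fintype ι] [DecidableEq ι]
    [Fintype α] [DecidableEq α] (ψ : (ι → α) → ℂ) (S : Finset ι) :
    Matrix ({i // i ∈ S} → α) ({i // i ∈ S} → α) ℂ :=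
  fun x y => ∑ z : {i // i ∉ S} → α,
    ψ (mergeOn S x z) * (starRingEnd ℂ) (ψ (mergeOn S y z))

/-- `k`-uniform: every reduction to at most `k` parties is ∝ identity. -/
def kUniform {ι α : Type*} [Fintype ι] [DecidableEq ι] [Fintype α] [DecidableEq α]
    (ψ : (ι → α) → ℂ) (k : ℕ) : Prop :=
  ∀ S : Finset ι, S.card ≤ k →
    ∃ c : ℂ, reducedMatrix ψ S = c • (1 : Matrix ({i // i ∈ S} → α) ({i // i ∈ S} → α) ℂ)

/-- The generalized Bell state `(X^l ⊗ Z^m) q^{-1/2} ∑_r |r,r⟩` of two qudits,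
written as a state of the two parties `Fin 2`. -/
noncomputable def bell {q : ℕ} (l m : Fin q) : (Fin 2 → Fin q) → ℂ :=
  fun x => if x 0 = x 1 + l then
    ((Real.sqrt q)⁻¹ : ℂ) * Complex.exp (2 * Real.pi * Complex.I / q) ^ ((m : ℕ) * ((x 1 : ℕ)))
  else 0

section PartialTrace

variable {ι κ α : Type*} [Fintype ι] [DecidableEq ι] [Fintype κ] [DecidableEq κ]
  [Fintype α] [DecidableEq α]

/-- The entry of `tr_{Sᶜ} |ψ⟩⟨χ|` at row `X|_S` and column `Y|_S`. -/
noncomputable def crossReduced (S : Finset ι) (X Y : ι → α) (ψ χ : (ι → α) → ℂ) : ℂ :=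
  ∑ u, ∑ v, if ∀ i, if i ∈ S then u i = X i ∧ v i = Y i else u i = v i then
    ψ u * (starRingEnd ℂ) (χ v) else 0

theorem reducedMatrix_eq_crossReduced (ψ : (ι → α) → ℂ) (S : Finset ι)
    (x y : {i // i ∈ S} → α) (X Y : ι → α) (hX : ∀ i : {i // i ∈ S}, X i = x i)
    (hY : ∀ i : {i // i ∈ S}, Y i = y i) :
    reducedMatrix ψ S x y = crossReduced S X Y ψ ψ := by
  unfold reducedMatrix crossReduced
  rw [← Finset.sum_product', ← Finset.sum_filter]
  refine Finset.sum_bij (fun z _ => (mergeOn S x z, mergeOn S y z)) ?_ ?_ ?_ ?_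
  · intro z _
    simp only [Finset.mem_filter, Finset.mem_product, Finset.mem_univ, true_and]
    intro i
    by_cases hi : i ∈ S
    · simp [mergeOn, hi, ← hX ⟨i, hi⟩, ← hY ⟨i, hi⟩]
    · simp [mergeOn, hi]
  · intro z _ z' _ h
    funext i
    have := congrFun (congrArg Prod.fst h) i.1
    simpa [mergeOn, i.2] using this
  · rintro ⟨u, v⟩ h
    simp only [Finset.mem_filter, Finset.mem_product, Finset.mem_univ, true_and] at h
    refine ⟨fun i => u i, Finset.mem_univ _, ?_⟩
    ext i
    · have := h i
      by_cases hi : i ∈ S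
      · simp only [hi, if_true] at this
        simp [mergeOn, hi, ← hX ⟨i, hi⟩, this.1]
      · simp [mergeOn, hi]
    · have := h i
      by_cases hi : i ∈ S
      · simp only [hi, if_true] at this
        simp [mergeOn, hi, ← hY ⟨i, hi⟩, this.2]
      · simp only [hi, if_false] at this
        simp [mergeOn, hi, this]
  · intro z _
    rfl

theorem kUniform_of_crossReduced (ψ : (ι → α) → ℂ) (k : ℕ) [Inhabited α]
    (h : ∀ S : Finset ι, S.card ≤ k → ∃ c : ℂ, ∀ X Y : ι → α,
      crossReduced S X Y ψ ψ = if ∀ i ∈ S, X i = Y i then c else 0) :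
    kUniform ψ k := by
  intro S hS
  obtain ⟨c, hc⟩ := h S hS
  refine ⟨c, ?_⟩
  ext x y
  rw [reducedMatrix_eq_crossReduced ψ S x y (mergeOn S x default) (mergeOn S y default)
    (fun i => by simp [mergeOn]) (fun i => by simp [mergeOn]), hc]
  have : (∀ i ∈ S, mergeOn S x default i = mergeOn S y default i) ↔ x = y := by
    constructor
    · intro H
      funext i
      simpa [mergeOn] using H i.1 i.2
    · rintro rfl i _
      rfl
  rw [if_congr this rfl rfl, Matrix.smul_apply, Matrix.one_apply]
  simp

theorem crossReduced_const_mul (S : Finset ι) (X Y : ι → α) (ψ χ : (ι → α) → ℂ) (k : ℂ) :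
    crossReduced S X Y (fun u => k * ψ u) (fun u => k * χ u) =
      k * (starRingEnd ℂ) k * crossReduced S X Y ψ χ := by
  simp only [crossReduced, Finset.mul_sum]
  refine Finset.sum_congr rfl fun u _ => Finset.sum_congr rfl fun v _ => ?_
  split_ifs
  · rw [map_mul]; ring
  · simp

theorem crossReduced_sum {A : Type*} [Fintype A] (S : Finset ι) (X Y : ι → α)
    (f g : A → (ι → α) → ℂ) :
    crossReduced S X Y (fun u => ∑ a, f a u) (fun u => ∑ a, g a u) =
      ∑ a, ∑ b, crossReduced S X Y (f a) (g b) := by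
  simp only [crossReduced]
  have : ∀ u v : ι → α, (if ∀ i, if i ∈ S then u i = X i ∧ v i = Y i else u i = v i then
      (∑ a, f a u) * (starRingEnd ℂ) (∑ a, g a v) else 0) = ∑ a, ∑ b,
      if ∀ i, if i ∈ S then u i = X i ∧ v i = Y i else u i = v i then
      f a u * (starRingEnd ℂ) (g b v) else 0 := by
    intro u v
    split_ifs
    · rw [map_sum, Finset.sum_mul_sum]
    · simp
  simp_rw [this]
  calc _ = ∑ u : ι → α, ∑ a, ∑ v : ι → α, ∑ b, _ :=
        Finset.sum_congr rfl fun u _ => Finset.sum_comm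
    _ = ∑ a, ∑ u : ι → α, ∑ v : ι → α, ∑ b, _ := Finset.sum_comm
    _ = ∑ a, ∑ u : ι → α, ∑ b, ∑ v : ι → α, _ :=
        Finset.sum_congr rfl fun a _ => Finset.sum_congr rfl fun u _ => Finset.sum_comm
    _ = _ := Finset.sum_congr rfl fun a _ => Finset.sum_comm

theorem crossReduced_basis_tensor (S : Finset (ι ⊕ κ)) (X Y : ι ⊕ κ → α) (p p' : ι → α)
    (β β' : (κ → α) → ℂ) :
    crossReduced S X Y
        (fun u => (if ∀ i, u (Sum.inl i) = p i then 1 else 0) * β (fun j => u (Sum.inr j)))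
        (fun u => (if ∀ i, u (Sum.inl i) = p' i then 1 else 0) * β' (fun j => u (Sum.inr j))) =
      if ∀ i, if i ∈ S.toLeft then p i = X (Sum.inl i) ∧ p' i = Y (Sum.inl i) else p i = p' i then
        crossReduced S.toRight (fun j => X (Sum.inr j)) (fun j => Y (Sum.inr j)) β β'
      else 0 := by
  have sum_split : ∀ f : (ι ⊕ κ → α) → ℂ,
      ∑ u, f u = ∑ a : ι → α, ∑ b : κ → α, f (Sum.elim a b) := by
    intro f
    rw [← (Equiv.sumArrowEquivProdArrow ι κ α).symm.sum_comp, Fintype.sum_prod_type]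
    rfl
  set P : Prop := ∀ i, if i ∈ S.toLeft then p i = X (Sum.inl i) ∧ p' i = Y (Sum.inl i)
    else p i = p' i with hP
  have key : ∀ (a a' : ι → α) (b b' : κ → α),
      (if ∀ i, if i ∈ S then Sum.elim a b i = X i ∧ Sum.elim a' b' i = Y i
          else Sum.elim a b i = Sum.elim a' b' i then
        ((if ∀ i, Sum.elim a b (Sum.inl i) = p i then 1 else 0) *
            β fun j => Sum.elim a b (Sum.inr j)) *
          (starRingEnd ℂ) ((if ∀ i, Sum.elim a' b' (Sum.inl i) = p' i then 1 else 0) *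
            β' fun j => Sum.elim a' b' (Sum.inr j)) else 0) =
      if a = p then if a' = p' then if P then
        (if ∀ j, if j ∈ S.toRight then b j = X (Sum.inr j) ∧ b' j = Y (Sum.inr j)
          else b j = b' j then β b * (starRingEnd ℂ) (β' b') else 0) else 0 else 0 else 0 := by
    intro a a' b b'
    simp only [Sum.forall, Sum.elim_inl, Sum.elim_inr, ← funext_iff, ← Finset.mem_toLeft,
      ← Finset.mem_toRight]
    by_cases ha : a = p
    · by_cases ha' : a' = p'
      · subst ha ha'
        simp only [if_true, one_mul, ite_and, hP]
      · simp [ha']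
    · simp [ha]
  simp only [crossReduced]
  rw [sum_split]
  simp_rw [sum_split, key]
  rw [Fintype.sum_eq_single p fun a ha => by simp [ha]]
  simp only [if_true, Finset.sum_ite_irrel, Finset.sum_const_zero, Finset.sum_ite_eq',
    Finset.mem_univ]
  rfl

end PartialTrace

section Bell

variable {q : ℕ}

theorem bell_mul_conj (l m l' m' : Fin q) (x y : Fin 2 → Fin q) :
    bell l m x * (starRingEnd ℂ) (bell l' m' y) =
      if x 0 = x 1 + l then if y 0 = y 1 + l' then
        (q : ℂ)⁻¹ * (Complex.exp (2 * Real.pi * Complex.I / q) ^ ((m : ℕ) * (x 1 : ℕ)) *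
          (starRingEnd ℂ) (Complex.exp (2 * Real.pi * Complex.I / q) ^ ((m' : ℕ) * (y 1 : ℕ))))
        else 0 else 0 := by
  have hs : ((Real.sqrt q : ℝ) : ℂ)⁻¹ * ((Real.sqrt q : ℝ) : ℂ)⁻¹ = (q : ℂ)⁻¹ := by
    rw [← mul_inv, ← Complex.ofReal_mul, Real.mul_self_sqrt (Nat.cast_nonneg q)]
    simp
  unfold bell
  split_ifs
  · rw [map_mul, map_inv₀, Complex.conj_ofReal, ← hs]
    ring
  · simp
  · simp
  · simp

theorem crossReduced_bell_univ (X Y : Fin 2 → Fin q) (l m l' m' : Fin q) :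
    crossReduced Finset.univ X Y (bell l m) (bell l' m') =
      bell l m X * (starRingEnd ℂ) (bell l' m' Y) := by
  simp only [crossReduced, Finset.mem_univ, if_true, forall_and, ← funext_iff, ite_and,
    Finset.sum_ite_irrel, Finset.sum_const_zero, Finset.sum_ite_eq']

variable [NeZero q]

theorem sum_root_pow_mul_conj (a b : Fin q) :
    ∑ k : Fin q, Complex.exp (2 * Real.pi * Complex.I / q) ^ ((a : ℕ) * (k : ℕ)) *
      (starRingEnd ℂ) (Complex.exp (2 * Real.pi * Complex.I / q) ^ ((b : ℕ) * (k : ℕ))) =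
    if a = b then (q : ℂ) else 0 := by
  have hω := Complex.isPrimitiveRoot_exp q (NeZero.ne q)
  set ω := Complex.exp (2 * Real.pi * Complex.I / q)
  have hconj : (starRingEnd ℂ) ω = ω⁻¹ :=
    (Complex.inv_eq_conj (hω.norm'_eq_one (NeZero.ne q))).symm
  have hω0 : ω ≠ 0 := hω.ne_zero (NeZero.ne q)
  have hterm : ∀ k : Fin q, ω ^ ((a : ℕ) * (k : ℕ)) * (starRingEnd ℂ) (ω ^ ((b : ℕ) * (k : ℕ))) =
      (ω ^ (a : ℕ) * (ω ^ (b : ℕ))⁻¹) ^ (k : ℕ) := by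
    intro k
    rw [map_pow, hconj, mul_pow, pow_mul, inv_pow, inv_pow, pow_mul]
  simp_rw [hterm]
  split_ifs with h
  · subst h
    simp [mul_inv_cancel₀ (pow_ne_zero _ hω0)]
  · set ζ := ω ^ (a : ℕ) * (ω ^ (b : ℕ))⁻¹ with hζ
    have h1 : ζ ≠ 1 := by
      intro h1
      rw [hζ, mul_inv_eq_one₀ (pow_ne_zero _ hω0)] at h1
      exact h (Fin.ext (hω.pow_inj a.2 b.2 h1))
    have hq : ζ ^ q = 1 := by
      rw [hζ, mul_pow, inv_pow, ← pow_mul, ← pow_mul, mul_comm, mul_comm (a : ℕ), mul_comm (b : ℕ),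
        pow_mul, pow_mul, hω.pow_eq_one]
      simp
    have := mul_geom_sum ζ q
    rw [hq, sub_self, Finset.sum_range] at this
    exact (mul_eq_zero.mp this).resolve_left (sub_ne_zero.mpr h1)

theorem root_pow_mul_conj_self (k : ℕ) :
    Complex.exp (2 * Real.pi * Complex.I / q) ^ k *
      (starRingEnd ℂ) (Complex.exp (2 * Real.pi * Complex.I / q) ^ k) = 1 := by
  have hω := Complex.isPrimitiveRoot_exp q (NeZero.ne q)
  rw [Complex.mul_conj', norm_pow, hω.norm'_eq_one (NeZero.ne q)]
  simp

theorem sum_bell_mul_conj_bell (i j : Fin q × Fin q) :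
    ∑ x, bell i.1 i.2 x * (starRingEnd ℂ) (bell j.1 j.2 x) = if i = j then 1 else 0 := by
  obtain ⟨l, m⟩ := i
  obtain ⟨l', m'⟩ := j
  simp_rw [bell_mul_conj]
  rw [← (finTwoArrowEquiv (Fin q)).symm.sum_comp, Fintype.sum_prod_type_right]
  simp only [finTwoArrowEquiv_symm_apply, Matrix.cons_val_zero, Matrix.cons_val_one,
    Finset.sum_ite_eq', Finset.mem_univ, if_true, add_right_inj,
    Finset.sum_ite_irrel, Finset.sum_const_zero, ← Finset.mul_sum, sum_root_pow_mul_conj]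
  have hq : (q : ℂ) ≠ 0 := Nat.cast_ne_zero.mpr (NeZero.ne q)
  by_cases hl : l = l' <;> by_cases hm : m = m' <;> simp [hl, hm, hq]

theorem sum_bell_apply_mul_conj (x y : Fin 2 → Fin q) :
    ∑ i : Fin q × Fin q, bell i.1 i.2 x * (starRingEnd ℂ) (bell i.1 i.2 y) =
      if x = y then 1 else 0 := by
  have hq : (q : ℂ) ≠ 0 := Nat.cast_ne_zero.mpr (NeZero.ne q)
  simp_rw [bell_mul_conj]
  rw [Fintype.sum_prod_type]
  have hchar : ∑ m : Fin q, Complex.exp (2 * Real.pi * Complex.I / q) ^ ((m : ℕ) * (x 1 : ℕ)) *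
      (starRingEnd ℂ) (Complex.exp (2 * Real.pi * Complex.I / q) ^ ((m : ℕ) * (y 1 : ℕ))) =
      if x 1 = y 1 then (q : ℂ) else 0 := by
    rw [← sum_root_pow_mul_conj]
    simp_rw [mul_comm]
  simp only [Finset.sum_ite_irrel, Finset.sum_const_zero, ← Finset.mul_sum, hchar]
  rw [Fintype.sum_eq_single (x 0 - x 1) fun l hl => if_neg fun h => hl (by rw [h]; abel)]
  by_cases h1 : x 1 = y 1
  · by_cases h0 : x 0 = y 0
    · have : x = y := by ext i; fin_cases i <;> simp [h0, h1]
      subst this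
      simp [hq]
    · have : x ≠ y := fun h => h0 (by rw [h])
      simp [this, h1, Ne.symm h0]
  · have : x ≠ y := fun h => h1 (by rw [h])
    simp [this, h1]

theorem crossReduced_bell_empty (X Y : Fin 2 → Fin q) (i j : Fin q × Fin q) :
    crossReduced ∅ X Y (bell i.1 i.2) (bell j.1 j.2) = if i = j then 1 else 0 := by
  simp only [crossReduced, Finset.notMem_empty, if_false, ← funext_iff, Finset.sum_ite_eq,
    Finset.mem_univ, if_true, sum_bell_mul_conj_bell]

theorem crossReduced_bell_singleton (s : Fin 2) (X Y : Fin 2 → Fin q) (l m : Fin q) :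
    crossReduced {s} X Y (bell l m) (bell l m) = if X s = Y s then (q : ℂ)⁻¹ else 0 := by
  have split : ∀ f : (Fin 2 → Fin q) → ℂ, ∑ u, f u = ∑ a, ∑ b, f ![a, b] := by
    intro f
    rw [← (finTwoArrowEquiv (Fin q)).symm.sum_comp, Fintype.sum_prod_type]
    rfl
  simp only [crossReduced, bell_mul_conj]
  simp_rw [split, Fin.forall_fin_two]
  fin_cases s
  · simp only [Fin.zero_eta, Finset.mem_singleton, if_true, one_ne_zero, if_false,
      Matrix.cons_val_zero, Matrix.cons_val_one, ite_and, Finset.sum_ite_irrel,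
      Finset.sum_const_zero, Finset.sum_ite_eq', Finset.sum_ite_eq, Finset.mem_univ]
    simp only [root_pow_mul_conj_self, mul_one]
    rw [Fintype.sum_eq_single (X 0 - l) fun a ha => if_neg fun h => ha (by rw [h]; abel)]
    simp [eq_comm]
  · by_cases h : X 1 = Y 1 <;>
      simp [ite_and, Finset.sum_ite_irrel, h, root_pow_mul_conj_self, -map_pow]

end Bell

section Code

theorem hammingDist_le_card_of_eqOn_compl {ι α : Type*} [Fintype ι] [DecidableEq α]
    {S : Finset ι} {x y : ι → α} (h : ∀ i ∉ S, x i = y i) : hammingDist x y ≤ S.card := by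
  refine Finset.card_le_card fun i hi => ?_
  by_contra hiS
  simp [h i hiS] at hi

/-- If the words `w a` restrict bijectively to the coordinates `T`, then the number of words
agreeing with `X` on `S ⊆ T` depends only on `S` and `T`. -/
theorem card_filter_agree_eq_prod {A ι α : Type*} [Fintype A] [DecidableEq ι] [Fintype α]
    [DecidableEq α] (w : A → ι → α) {S T : Finset ι} (hST : S ⊆ T)
    (hw : Function.Bijective fun a (t : T) => w a t) (X : ι → α)
    [DecidablePred fun a => ∀ i ∈ S, w a i = X i] :
    (Finset.univ.filter fun a => ∀ i ∈ S, w a i = X i).card =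
      ∏ t : T, if (t : ι) ∈ S then 1 else Fintype.card α := by
  have h : (Finset.univ.filter fun a => ∀ i ∈ S, w a i = X i).card =
      (Fintype.piFinset fun t : T => if (t : ι) ∈ S then {X t} else Finset.univ).card := by
    refine Finset.card_bij (fun a _ t => w a t) ?_ (fun a _ b _ h => hw.injective h) ?_
    · intro a ha
      rw [Fintype.mem_piFinset]
      intro t
      split_ifs with ht
      · simpa using (Finset.mem_filter.mp ha).2 t ht
      · exact Finset.mem_univ _
    · intro f hf
      rw [Fintype.mem_piFinset] at hf
      obtain ⟨a, ha⟩ := hw.surjective f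
      refine ⟨a, ?_, ha⟩
      simp only [Finset.mem_filter, Finset.mem_univ, true_and]
      intro i hi
      have h1 := hf ⟨i, hST hi⟩
      simp only [hi, if_true, Finset.mem_singleton] at h1
      rw [← h1, ← ha]
  rw [h, Fintype.card_piFinset]
  exact Finset.prod_congr rfl fun t _ => by split_ifs <;> simp

end Code

/-- **Cl+Q with repetition (Lemma 3)**: let `C` be an `[n_c, ⌈n_c/2⌉]_q` MDS code
(pairwise distance ≥ `⌊n_c/2⌋ + 1`) whose codewords are partitioned into `q²`
classes, each a coset of an `[n_c, ⌈n_c/2⌉ - 2]_q` MDS code (pairwise distance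
`≥ ⌊n_c/2⌋ + 3` within a class, projections onto any `⌈n_c/2⌉ - 2` coordinates
bijective).  Concatenating each codeword with the Bell state labelled by its
class gives a state of `n = n_c + 2` qudits (`n` odd) all of whose reductions to
`⌊n/2⌋` parties are maximally mixed, i.e. an `AME(n_c + 2, q)` state. -/
theorem clq_with_repetition_AME {F : Type*} [Field F] [Fintype F] [DecidableEq F]
    {nc q : ℕ} [NeZero q] (hq : Fintype.card F = q) (e : F ≃ Fin q)
    (hodd : Odd (nc + 2))
    (C : Submodule F (Fin nc → F)) [DecidablePred (· ∈ C)]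
    (hk : Module.finrank F C = (nc + 1) / 2)
    (hdistC : ∀ c c' : C, c ≠ c' →
      nc / 2 + 1 ≤ hammingDist (c : Fin nc → F) (c' : Fin nc → F))
    (cls : C → Fin q × Fin q)
    (hdistCls : ∀ c c' : C, c ≠ c' → cls c = cls c' →
      nc / 2 + 3 ≤ hammingDist (c : Fin nc → F) (c' : Fin nc → F))
    (hproj : ∀ (i : Fin q × Fin q) (T : Finset (Fin nc)), T.card = (nc + 1) / 2 - 2 →
      Function.Bijective (fun (c : {c : C // cls c = i}) =>
        (fun t : {j // j ∈ T} => (((c : C) : Fin nc → F) t))))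
    (φ : ((Fin nc ⊕ Fin 2) → Fin q) → ℂ)
    (hφ : φ = fun x => ((Real.sqrt ((q : ℝ) ^ ((nc + 1) / 2)))⁻¹ : ℂ) *
      ∑ c : C, (if (∀ i : Fin nc, x (Sum.inl i) = e ((c : Fin nc → F) i)) then 1 else 0) *
        bell (cls c).1 (cls c).2 (fun j => x (Sum.inr j))) :
    kUniform φ ((nc + 2) / 2) := by
  have hq0 : 0 < q := Nat.pos_of_ne_zero (NeZero.ne q)
  have hcard : Fintype.card C = q ^ ((nc + 1) / 2) := by
    rw [← hk, ← hq, Module.card_eq_pow_finrank (K := F)]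
  have hnc : 2 ≤ (nc + 1) / 2 := by
    by_contra h
    have hsurj : Function.Surjective cls := fun i => by
      obtain ⟨⟨c, hc⟩, -⟩ := (hproj i ∅ (by rw [Finset.card_empty]; omega)).surjective fun _ => 0
      exact ⟨c, hc⟩
    have h1 := Fintype.card_le_of_surjective cls hsurj
    rw [hcard, Fintype.card_prod, Fintype.card_fin] at h1
    have h2 : q ^ ((nc + 1) / 2) ≤ q ^ 1 := Nat.pow_le_pow_right hq0 (by omega)
    have h3 : 1 < q := hq ▸ Fintype.one_lt_card
    nlinarith
  obtain ⟨t, ht⟩ : ∃ t, nc = 2 * t + 3 := by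
    obtain ⟨r, hr⟩ := hodd
    exact ⟨r - 2, by omega⟩
  have hbij : ∀ T : Finset (Fin nc), T.card = (nc + 1) / 2 →
      Function.Bijective fun (c : C) (j : T) => e ((c : Fin nc → F) j) := by
    intro T hT
    rw [Fintype.bijective_iff_injective_and_card]
    refine ⟨fun c c' h => ?_, by simp [hcard, hT]⟩
    by_contra hne
    have h1 := hdistC c c' hne
    have h2 := hammingDist_le_card_of_eqOn_compl (S := Tᶜ) (x := (c : Fin nc → F)) (y := c')
      fun i hi => e.injective (congrFun h ⟨i, by simpa using hi⟩)
    rw [Finset.card_compl, hT, Fintype.card_fin] at h2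
    omega
  subst hφ
  refine kUniform_of_crossReduced _ _ fun S hS => ?_
  have hScard := S.card_toLeft_add_card_toRight
  suffices h : ∃ r : ℂ, ∀ X Y : Fin nc ⊕ Fin 2 → Fin q,
      (∀ c c' : C, c ≠ c' → (∀ i ∉ S.toLeft, (c : Fin nc → F) i = (c' : Fin nc → F) i) →
        crossReduced S.toRight (fun j => X (Sum.inr j)) (fun j => Y (Sum.inr j))
          (bell (cls c).1 (cls c).2) (bell (cls c').1 (cls c').2) = 0) ∧
      (∑ c : C, if ∀ i ∈ S.toLeft, e ((c : Fin nc → F) i) = X (Sum.inl i) then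
        crossReduced S.toRight (fun j => X (Sum.inr j)) (fun j => Y (Sum.inr j))
          (bell (cls c).1 (cls c).2) (bell (cls c).1 (cls c).2) else 0) =
        if ∀ j ∈ S.toRight, X (Sum.inr j) = Y (Sum.inr j) then r else 0 by
    obtain ⟨r, hr⟩ := h
    set k : ℂ := ((Real.sqrt ((q : ℝ) ^ ((nc + 1) / 2)))⁻¹ : ℂ)
    refine ⟨k * (starRingEnd ℂ) k * r, fun X Y => ?_⟩
    obtain ⟨hoff, hdiag⟩ := hr X Y
    rw [crossReduced_const_mul, crossReduced_sum]
    have hrow : ∀ c : C, ∑ c' : C, crossReduced S X Y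
        (fun x => (if ∀ i, x (Sum.inl i) = e ((c : Fin nc → F) i) then 1 else 0) *
          bell (cls c).1 (cls c).2 fun j => x (Sum.inr j))
        (fun x => (if ∀ i, x (Sum.inl i) = e ((c' : Fin nc → F) i) then 1 else 0) *
          bell (cls c').1 (cls c').2 fun j => x (Sum.inr j)) =
        if ∀ i ∈ S.toLeft, X (Sum.inl i) = Y (Sum.inl i) then
          if ∀ i ∈ S.toLeft, e ((c : Fin nc → F) i) = X (Sum.inl i) then
            crossReduced S.toRight (fun j => X (Sum.inr j)) (fun j => Y (Sum.inr j))
              (bell (cls c).1 (cls c).2) (bell (cls c).1 (cls c).2) else 0 else 0 := by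
      intro c
      have htensor : ∀ c' : C, crossReduced S X Y
          (fun x => (if ∀ i, x (Sum.inl i) = e ((c : Fin nc → F) i) then 1 else 0) *
            bell (cls c).1 (cls c).2 fun j => x (Sum.inr j))
          (fun x => (if ∀ i, x (Sum.inl i) = e ((c' : Fin nc → F) i) then 1 else 0) *
            bell (cls c').1 (cls c').2 fun j => x (Sum.inr j)) =
          if ∀ i, if i ∈ S.toLeft then e ((c : Fin nc → F) i) = X (Sum.inl i) ∧
              e ((c' : Fin nc → F) i) = Y (Sum.inl i)
            else e ((c : Fin nc → F) i) = e ((c' : Fin nc → F) i) then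
          crossReduced S.toRight (fun j => X (Sum.inr j)) (fun j => Y (Sum.inr j))
            (bell (cls c).1 (cls c).2) (bell (cls c').1 (cls c').2) else 0 := by
        intro c'
        convert crossReduced_basis_tensor S X Y (fun i => e ((c : Fin nc → F) i))
          (fun i => e ((c' : Fin nc → F) i)) (bell (cls c).1 (cls c).2)
          (bell (cls c').1 (cls c').2)
      simp_rw [htensor]
      rw [Fintype.sum_eq_single c, ← ite_and]
      · refine if_congr ⟨fun h => ?_, fun h i => ?_⟩ rfl rfl
        · refine ⟨fun i hi => ?_, fun i hi => ?_⟩ <;>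
          · have h1 := h i
            rw [if_pos hi] at h1
            simp [← h1.1, ← h1.2]
        · split_ifs with hi
          · exact ⟨h.2 i hi, (h.2 i hi).trans (h.1 i hi)⟩
          · rfl
      · intro c' hne
        split_ifs with h
        · refine hoff c c' hne.symm fun i hi => e.injective ?_
          have h1 := h i
          rwa [if_neg hi] at h1
        · rfl
    simp_rw [hrow]
    rw [Finset.sum_ite_irrel, hdiag, Finset.sum_const_zero, ← ite_and, mul_ite, mul_zero]
    simp only [Sum.forall, Finset.mem_toLeft, Finset.mem_toRight]
  have hagree : ∀ c c' : C, (∀ i ∉ S.toLeft, (c : Fin nc → F) i = (c' : Fin nc → F) i) →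
      hammingDist (c : Fin nc → F) c' ≤ S.toLeft.card :=
    fun c c' h => hammingDist_le_card_of_eqOn_compl h
  have hR : S.toRight.card ≤ 2 := by simpa using S.toRight.card_le_univ
  obtain h0 | h1 | h2 : S.toRight.card = 0 ∨ S.toRight.card = 1 ∨ S.toRight.card = 2 := by omega
  · obtain ⟨T, hST, hT⟩ := Finset.exists_superset_card_eq (s := S.toLeft) (n := (nc + 1) / 2)
      (by omega) (by rw [Fintype.card_fin]; omega)
    rw [Finset.card_eq_zero.mp h0]
    refine ⟨((∏ t : T, if (t : Fin nc) ∈ S.toLeft then 1 else Fintype.card (Fin q) : ℕ) : ℂ),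
      fun X Y => ⟨fun c c' hne h => ?_, ?_⟩⟩
    · rw [crossReduced_bell_empty, if_neg]
      intro hcls
      have := hdistCls c c' hne hcls
      have := hagree c c' h
      omega
    · simp only [crossReduced_bell_empty, if_true]
      rw [if_pos (by simp), Finset.sum_boole, card_filter_agree_eq_prod
        (fun (c : C) i => e ((c : Fin nc → F) i)) hST (hbij T hT) fun i => X (Sum.inl i)]
  · obtain ⟨T, hST, hT⟩ := Finset.exists_superset_card_eq (s := S.toLeft) (n := (nc + 1) / 2)
      (by omega) (by rw [Fintype.card_fin]; omega)
    obtain ⟨s, hs⟩ := Finset.card_eq_one.mp h1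
    rw [hs]
    refine ⟨(∏ t : T, if (t : Fin nc) ∈ S.toLeft then 1 else Fintype.card (Fin q)) • (q : ℂ)⁻¹,
      fun X Y => ⟨fun c c' hne h => ?_, ?_⟩⟩
    · have := hdistC c c' hne
      have := hagree c c' h
      omega
    · simp only [crossReduced_bell_singleton, Finset.mem_singleton, forall_eq]
      rw [← Finset.sum_filter, Finset.sum_const, card_filter_agree_eq_prod
        (fun (c : C) i => e ((c : Fin nc → F) i)) hST (hbij T hT) fun i => X (Sum.inl i),
        smul_ite, smul_zero]
  · obtain ⟨T, hST, hT⟩ := Finset.exists_superset_card_eq (s := S.toLeft) (n := (nc + 1) / 2 - 2)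
      (by omega) (by rw [Fintype.card_fin]; omega)
    rw [(Finset.card_eq_iff_eq_univ _).mp (h2.trans (Fintype.card_fin 2).symm)]
    refine ⟨((∏ t : T, if (t : Fin nc) ∈ S.toLeft then 1 else Fintype.card (Fin q) : ℕ) : ℂ),
      fun X Y => ⟨fun c c' hne h => ?_, ?_⟩⟩
    · have := hdistC c c' hne
      have := hagree c c' h
      omega
    · simp only [crossReduced_bell_univ, Finset.mem_univ, true_implies]
      rw [← Finset.sum_fiberwise Finset.univ cls]
      have hfib : ∀ i, ∑ c with cls c = i,
          (if ∀ j ∈ S.toLeft, e ((c : Fin nc → F) j) = X (Sum.inl j) then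
            bell (cls c).1 (cls c).2 (fun j => X (Sum.inr j)) *
              (starRingEnd ℂ) (bell (cls c).1 (cls c).2 fun j => Y (Sum.inr j)) else 0) =
          ((∏ t : T, if (t : Fin nc) ∈ S.toLeft then 1 else Fintype.card (Fin q) : ℕ) : ℂ) *
            (bell i.1 i.2 (fun j => X (Sum.inr j)) *
              (starRingEnd ℂ) (bell i.1 i.2 fun j => Y (Sum.inr j))) := by
        intro i
        rw [← card_filter_agree_eq_prod
          (fun (c : {c : C // cls c = i}) j => e (((c : C) : Fin nc → F) j)) hST
          (((Equiv.refl T).arrowCongr e).bijective.comp (hproj i T hT)) fun j => X (Sum.inl j),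
          ← nsmul_eq_mul, ← Finset.sum_const, Finset.sum_subtype (p := fun c => cls c = i)
            (Finset.univ.filter fun c => cls c = i) (fun c => by simp), Finset.sum_filter]
        exact Finset.sum_congr rfl fun c _ => by rw [c.2]
      rw [Finset.sum_congr rfl fun i _ => hfib i, ← Finset.mul_sum, sum_bell_apply_mul_conj,
        mul_ite, mul_one, mul_zero]
      simp only [funext_iff]
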